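/- arXiv:1110.5021 — 10 statements merged into one kernel-verified Lean document; each statement's English description precedes it below -/
import Mathlib

section
/- Let K = (α,β,β̂,γ,γ̂,λ,δ,δ̂,ω) ∈ ℝ⁹ be a nonzero vector of coefficients of the EYdKN equation. Then there exists a finite composition g of the allowed transformations T_κ (κ ∈ ℝ), D_κ (κ ≠ 0), I and S_μ (μ ≠ 0) such that g(K) satisfies one of the following three normal forms: (1) α = 1 and β = 0; (2) α = 0, β = 1, γ = 0, β̂ = −1, γ̂ = −2λ, δ̂ = −δ, ω = 0; (3) α = 0, β = 0, γ = 1, β̂ = 0, δ = 0, δ̂ = 0, λ = −1, γ̂ = 1, ω = 0. In each normal form the polynomial P(u) = αu² + 2βu + γ is not identically zero. -/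
/-- Coefficient vector K = (α, β, β̂, γ, γ̂, λ, δ, δ̂, ω) of the EYdKN equation. -/
structure Coeffs where
  alpha : ℝ
  beta : ℝ
  betah : ℝ
  gamma : ℝ
  gammah : ℝ
  lam : ℝ
  delta : ℝ
  deltah : ℝ
  omega : ℝ

/-- Translation T_κ acting on the coefficients. -/
def Ttrans (κ : ℝ) (K : Coeffs) : Coeffs :=
  ⟨K.alpha,
   K.beta + K.alpha * κ,
   K.betah + K.alpha * κ,
   K.gamma + 2 * K.beta * κ + K.alpha * κ ^ 2,
   K.gammah + 2 * K.betah * κ + K.alpha * κ ^ 2,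
   K.lam + 2 * (K.beta + K.betah) * κ + 2 * K.alpha * κ ^ 2,
   K.delta + (K.gamma + K.lam) * κ + (2 * K.beta + K.betah) * κ ^ 2 + K.alpha * κ ^ 3,
   K.deltah + (K.gammah + K.lam) * κ + (K.beta + 2 * K.betah) * κ ^ 2 + K.alpha * κ ^ 3,
   K.omega + 2 * (K.delta + K.deltah) * κ + (K.gamma + K.gammah + 2 * K.lam) * κ ^ 2
     + 2 * (K.beta + K.betah) * κ ^ 3 + K.alpha * κ ^ 4⟩

/-- Dilation D_κ (κ ≠ 0) acting on the coefficients. -/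
noncomputable def Dil (κ : ℝ) (K : Coeffs) : Coeffs :=
  ⟨K.alpha * κ ^ 2, K.beta * κ, K.betah * κ, K.gamma, K.gammah, K.lam,
   K.delta / κ, K.deltah / κ, K.omega / κ ^ 2⟩

/-- Inversion I acting on the coefficients. -/
def Inversion (K : Coeffs) : Coeffs :=
  ⟨K.omega, K.deltah, K.delta, K.gammah, K.gamma, K.lam, K.betah, K.beta, K.alpha⟩

/-- Time rescaling S_μ (μ ≠ 0) acting on the coefficients. -/
def Scale (μ : ℝ) (K : Coeffs) : Coeffs :=
  ⟨μ * K.alpha, μ * K.beta, μ * K.betah, μ * K.gamma, μ * K.gammah, μ * K.lam,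
   μ * K.delta, μ * K.deltah, μ * K.omega⟩

/-- A map is an allowed transformation if it is a translation, a dilation with
nonzero parameter, the inversion, or a time rescaling with nonzero parameter. -/
def IsAllowed (g : Coeffs → Coeffs) : Prop :=
  (∃ κ : ℝ, g = Ttrans κ) ∨ (∃ κ : ℝ, κ ≠ 0 ∧ g = Dil κ) ∨ (g = Inversion) ∨
    (∃ μ : ℝ, μ ≠ 0 ∧ g = Scale μ)

/-- The three normal forms, each with `P` not identically zero. -/
def IsNormalForm (K : Coeffs) : Prop :=
  ((K.alpha = 1 ∧ K.beta = 0) ∨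
   (K.alpha = 0 ∧ K.beta = 1 ∧ K.gamma = 0 ∧ K.betah = -1 ∧
    K.gammah = -2 * K.lam ∧ K.deltah = -K.delta ∧ K.omega = 0) ∨
   (K.alpha = 0 ∧ K.beta = 0 ∧ K.gamma = 1 ∧ K.betah = 0 ∧
    K.delta = 0 ∧ K.deltah = 0 ∧ K.lam = -1 ∧ K.gammah = 1 ∧
    K.omega = 0)) ∧
  ¬(K.alpha = 0 ∧ K.beta = 0 ∧ K.gamma = 0)

/-- Some finite composition of allowed transformations brings `K` to a normal form. -/
def HasNormalForm (K : Coeffs) : Prop :=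
  ∃ l : List (Coeffs → Coeffs),
    (∀ g ∈ l, IsAllowed g) ∧ IsNormalForm (l.foldl (fun c g => g c) K)

namespace HasNormalForm

theorem of_isNormalForm {K : Coeffs} (h : IsNormalForm K) : HasNormalForm K :=
  ⟨[], by simp, h⟩

theorem of_isAllowed {g : Coeffs → Coeffs} {K : Coeffs} (hg : IsAllowed g)
    (h : HasNormalForm (g K)) : HasNormalForm K := by
  obtain ⟨l, hl, hn⟩ := h
  exact ⟨g :: l, by simpa using ⟨hg, hl⟩, hn⟩

theorem of_trans (κ : ℝ) {K : Coeffs} (h : HasNormalForm (Ttrans κ K)) : HasNormalForm K :=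
  of_isAllowed (.inl ⟨κ, rfl⟩) h

theorem of_inversion {K : Coeffs} (h : HasNormalForm (Inversion K)) : HasNormalForm K :=
  of_isAllowed (.inr (.inr (.inl rfl))) h

theorem of_scale {μ : ℝ} (hμ : μ ≠ 0) {K : Coeffs} (h : HasNormalForm (Scale μ K)) :
    HasNormalForm K :=
  of_isAllowed (.inr (.inr (.inr ⟨μ, hμ, rfl⟩))) h

theorem of_alpha_ne_zero {K : Coeffs} (h : K.alpha ≠ 0) : HasNormalForm K := by
  refine of_scale (inv_ne_zero h) (of_trans (-(K.alpha⁻¹ * K.beta)) (of_isNormalForm ?_))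
  simp [IsNormalForm, Ttrans, Scale, h]

theorem of_omega_ne_zero {K : Coeffs} (h : K.omega ≠ 0) : HasNormalForm K :=
  of_inversion (of_alpha_ne_zero h)

end HasNormalForm

/-- The biquadratic form attached to `K` vanishes identically on the diagonal. -/
structure VanishesOnDiagonal (K : Coeffs) : Prop where
  alpha : K.alpha = 0
  betah : K.betah = -K.beta
  gammah : K.gammah = -K.gamma - 2 * K.lam
  deltah : K.deltah = -K.delta
  omega : K.omega = 0

theorem vanishesOnDiagonal_of_forall_omega {K : Coeffs}
    (h : ∀ κ, (Ttrans κ K).omega = 0) : VanishesOnDiagonal K := by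
  have h0 := h 0
  have h1 := h 1
  have h2 := h (-1)
  have h3 := h 2
  have h4 := h (-2)
  simp only [Ttrans] at h0 h1 h2 h3 h4
  constructor <;> linarith

namespace VanishesOnDiagonal

theorem inversion {K : Coeffs} (h : VanishesOnDiagonal K) : VanishesOnDiagonal (Inversion K) := by
  obtain ⟨h1, h2, h3, h4, h5⟩ := h
  constructor <;> simp only [Inversion] <;> linarith

theorem trans {K : Coeffs} (h : VanishesOnDiagonal K) (κ : ℝ) :
    VanishesOnDiagonal (Ttrans κ K) := by
  obtain ⟨h1, h2, h3, h4, h5⟩ := h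
  constructor <;> simp only [Ttrans, h1, h2, h3, h4, h5] <;> ring

theorem hasNormalForm_of_beta_ne_zero {K : Coeffs} (h : VanishesOnDiagonal K)
    (hb : K.beta ≠ 0) : HasNormalForm K := by
  refine .of_scale (inv_ne_zero hb) (.of_trans (-(K.beta⁻¹ * K.gamma) / 2)
    (.of_isNormalForm ⟨.inr (.inl ?_), ?_⟩))
  · obtain ⟨h1, h2, h3, h4, h5⟩ := h
    simp only [Ttrans, Scale, h1, h2, h3, h4, h5]
    refine ⟨?_, ?_, ?_, ?_, ?_, ?_, ?_⟩ <;> field_simp <;> ring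
  · simp [Ttrans, Scale, h.alpha, hb]

theorem hasNormalForm_of_delta_ne_zero {K : Coeffs} (h : VanishesOnDiagonal K)
    (hd : K.delta ≠ 0) : HasNormalForm K :=
  .of_inversion (h.inversion.hasNormalForm_of_beta_ne_zero (by simpa [Inversion, h.deltah]))

theorem hasNormalForm {K : Coeffs} (h : VanishesOnDiagonal K)
    (hK : K ≠ ⟨0, 0, 0, 0, 0, 0, 0, 0, 0⟩) : HasNormalForm K := by
  by_cases hb : K.beta = 0
  swap
  · exact h.hasNormalForm_of_beta_ne_zero hb
  by_cases hd : K.delta = 0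
  swap
  · exact h.hasNormalForm_of_delta_ne_zero hd
  by_cases hl : K.gamma + K.lam = 0
  swap
  · exact .of_trans 1 ((h.trans 1).hasNormalForm_of_delta_ne_zero
      (by simpa [Ttrans, h.alpha, h.betah, hb, hd]))
  obtain ⟨h1, h2, h3, h4, h5⟩ := h
  have hlam : K.lam = -K.gamma := by linarith
  have hgammah : K.gammah = K.gamma := by linarith
  have hg : K.gamma ≠ 0 := by
    intro hg
    apply hK
    cases K
    simp_all
  refine .of_scale (inv_ne_zero hg) (.of_isNormalForm ?_)
  simp [IsNormalForm, Scale, h1, h2, h4, h5, hlam, hgammah, hb, hd, hg]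

end VanishesOnDiagonal

theorem eydkn_normal_forms (K : Coeffs)
    (hK : K ≠ ⟨0, 0, 0, 0, 0, 0, 0, 0, 0⟩) :
    ∃ (l : List (Coeffs → Coeffs)) (K' : Coeffs),
      (∀ g ∈ l, IsAllowed g) ∧
      K' = l.foldl (fun c g => g c) K ∧
      ((K'.alpha = 1 ∧ K'.beta = 0) ∨
       (K'.alpha = 0 ∧ K'.beta = 1 ∧ K'.gamma = 0 ∧ K'.betah = -1 ∧
        K'.gammah = -2 * K'.lam ∧ K'.deltah = -K'.delta ∧ K'.omega = 0) ∨
       (K'.alpha = 0 ∧ K'.beta = 0 ∧ K'.gamma = 1 ∧ K'.betah = 0 ∧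
        K'.delta = 0 ∧ K'.deltah = 0 ∧ K'.lam = -1 ∧ K'.gammah = 1 ∧
        K'.omega = 0)) ∧
      ¬(K'.alpha = 0 ∧ K'.beta = 0 ∧ K'.gamma = 0) := by
  have h : HasNormalForm K := by
    by_cases h : ∀ κ, (Ttrans κ K).omega = 0
    · exact (vanishesOnDiagonal_of_forall_omega h).hasNormalForm hK
    · push Not at h
      obtain ⟨κ, hκ⟩ := h
      exact .of_trans κ (.of_omega_ne_zero hκ)
  obtain ⟨l, hl, hn⟩ := h
  exact ⟨l, _, hl, rfl, hn⟩
end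

section
/- Let α,β,β̂,γ,γ̂,λ,δ,δ̂,ω ∈ ℝ with (α,β,γ) ≠ (0,0,0) (so the polynomial P(u) = αu² + 2βu + γ is not identically zero). Suppose τ : ℝ → ℝ is C² and φ : ℤ → ℝ → ℝ → ℝ is such that each (t,u) ↦ φ(n,t,u) is C², and the pair (τ,φ) satisfies the symmetry determining equation of the EYdKN equation identically. Then there exist constants τ₀, τ₁, a, â, b, b̂, c, ĉ ∈ ℝ such that τ(t) = τ₀ + τ₁ t for all t, and φ(n,t,u) = (a + â(−1)ⁿ) + (b + b̂(−1)ⁿ)u + (c + ĉ(−1)ⁿ)u² for all n ∈ ℤ, t ∈ ℝ, u ∈ ℝ. -/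
/-- The symmetry determining equation of the EYdKN equation with coefficients
(α, β, β̂, γ, γ̂, λ, δ, δ̂, ω), where P(u) = αu² + 2βu + γ, Q(u) = β̂u² + λu + δ,
R(u) = γ̂u² + 2δ̂u + ω. -/
def DetEqEY (α β βh γ γh lam δ δh ω : ℝ) (τ : ℝ → ℝ) (φ : ℤ → ℝ → ℝ → ℝ) : Prop :=
  ∀ (n : ℤ) (t x y z : ℝ),
    deriv (fun s => φ n s y) t * (z - x) ^ 2
    + (deriv (fun v => φ n t v) y - deriv τ t) *
      ((α * y ^ 2 + 2 * β * y + γ) * z * x + (βh * y ^ 2 + lam * y + δ) * (z + x)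
        + (γh * y ^ 2 + 2 * δh * y + ω)) * (z - x)
    - φ n t y *
      ((2 * α * y + 2 * β) * z * x + (2 * βh * y + lam) * (z + x)
        + (2 * γh * y + 2 * δh)) * (z - x)
    = φ (n - 1) t x * ((α * y ^ 2 + 2 * β * y + γ) * z ^ 2
        + 2 * (βh * y ^ 2 + lam * y + δ) * z + (γh * y ^ 2 + 2 * δh * y + ω))
    - φ (n + 1) t z * ((α * y ^ 2 + 2 * β * y + γ) * x ^ 2
        + 2 * (βh * y ^ 2 + lam * y + δ) * x + (γh * y ^ 2 + 2 * δh * y + ω))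

lemma finite_setOf_quadratic_eq_zero {p : ℝ} (hp : p ≠ 0) (q r : ℝ) :
    {x : ℝ | p * x ^ 2 + q * x + r = 0}.Finite := by
  have hne : (Polynomial.C p * Polynomial.X ^ 2 + Polynomial.C q * Polynomial.X
      + Polynomial.C r : Polynomial ℝ) ≠ 0 := by
    intro h
    have := Polynomial.natDegree_quadratic (b := q) (c := r) hp
    simp [h] at this
  refine (Polynomial.finite_setOfPred_isRoot hne).subset fun x hx => ?_
  simpa [Polynomial.IsRoot] using hx

lemma exists_quadratic_ne_zero {α β γ : ℝ} (hP : ¬(α = 0 ∧ β = 0 ∧ γ = 0)) :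
    ∃ y : ℝ, α * y ^ 2 + 2 * β * y + γ ≠ 0 := by
  by_contra! h
  have h0 := h 0
  have h1 := h 1
  have h2 := h (-1)
  exact hP ⟨by linarith, by linarith, by linarith⟩

namespace DetEqEY

variable {α β βh γ γh lam δ δh ω : ℝ} {τ : ℝ → ℝ} {φ : ℤ → ℝ → ℝ → ℝ}

lemma apply_add_two (hdet : DetEqEY α β βh γ γh lam δ δh ω τ φ)
    (hP : ¬(α = 0 ∧ β = 0 ∧ γ = 0)) (hφ : ∀ n t, Continuous (φ n t)) (n : ℤ) :
    φ (n + 2) = φ n := by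
  obtain ⟨y, hy⟩ := exists_quadratic_ne_zero hP
  funext t
  refine Continuous.ext_on ((finite_setOf_quadratic_eq_zero hy
      (2 * (βh * y ^ 2 + lam * y + δ)) (γh * y ^ 2 + 2 * δh * y + ω))
    |>.countable.dense_compl ℝ)
    (hφ _ t) (hφ _ t) fun x hx => ?_
  have h := hdet (n + 1) t x y x
  rw [show n + 1 - 1 = n by ring, show n + 1 + 1 = n + 2 by ring] at h
  exact mul_right_cancel₀ hx (by linear_combination h)

lemma deriv_time_eq_zero (hdet : DetEqEY α β βh γ γh lam δ δh ω τ φ)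
    (hper : ∀ n, φ (n + 2) = φ n) (n : ℤ) (t y : ℝ) :
    deriv (fun s => φ n s y) t = 0 := by
  have h₁ := hdet n t 0 y 1
  have h₂ := hdet n t 1 y 0
  have hn : φ (n + 1) = φ (n - 1) := by
    rw [← hper (n - 1)]
    congr 1
    ring
  rw [hn] at h₁ h₂
  linear_combination (h₁ + h₂) / 2

lemma exists_quadratic (hdet : DetEqEY α β βh γ γh lam δ δh ω τ φ)
    (hP : ¬(α = 0 ∧ β = 0 ∧ γ = 0)) (n : ℤ) (t : ℝ) :
    ∃ a b c : ℝ, ∀ u, φ n t u = a + b * u + c * u ^ 2 := by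
  obtain ⟨y, hy⟩ := exists_quadratic_ne_zero hP
  obtain ⟨z, hz⟩ := (finite_setOf_quadratic_eq_zero hy
    (2 * (βh * y ^ 2 + lam * y + δ)) (γh * y ^ 2 + 2 * δh * y + ω)).infinite_compl.nonempty
  have h := fun u => hdet (n + 1) t u y z
  rw [show n + 1 - 1 = n by ring] at h
  simp only [Set.mem_compl_iff, Set.mem_ofPred_eq] at hz
  generalize α * y ^ 2 + 2 * β * y + γ = p at *
  generalize βh * y ^ 2 + lam * y + δ = q at *
  generalize γh * y ^ 2 + 2 * δh * y + ω = r at *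
  generalize 2 * α * y + 2 * β = p' at *
  generalize 2 * βh * y + lam = q' at *
  generalize 2 * γh * y + 2 * δh = r' at *
  generalize deriv (fun s => φ (n + 1) s y) t = d at *
  generalize deriv (fun v => φ (n + 1) t v) y - deriv τ t = e at *
  generalize φ (n + 1) t y = f at *
  generalize φ (n + 1 + 1) t z = k at *
  generalize p * z ^ 2 + 2 * q * z + r = g at *
  refine ⟨(k * r + d * z ^ 2 + e * (q * z + r) * z - f * (q' * z + r') * z) / g,
    (2 * k * q - 2 * d * z + e * (p * z ^ 2 - r) - f * (p' * z ^ 2 - r')) / g,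
    (k * p + d - e * (p * z + q) + f * (p' * z + q')) / g, fun u => ?_⟩
  field_simp
  linear_combination -h u

lemma deriv_tau_eq (hdet : DetEqEY α β βh γ γh lam δ δh ω τ φ)
    (hP : ¬(α = 0 ∧ β = 0 ∧ γ = 0)) (hconst : ∀ n s t, φ n s = φ n t) (t : ℝ) :
    deriv τ t = deriv τ 0 := by
  obtain ⟨y, hy⟩ := exists_quadratic_ne_zero hP
  have key : ∀ z : ℝ, (deriv τ t - deriv τ 0) *
      ((γh * y ^ 2 + 2 * δh * y + ω) - (α * y ^ 2 + 2 * β * y + γ) * z ^ 2) * z = 0 := by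
    intro z
    have h := hdet 0 t (-z) y z
    have h₀ := hdet 0 0 (-z) y z
    have hd : ∀ s, deriv (fun s => φ 0 s y) s = 0 := fun s => by
      rw [show (fun s => φ 0 s y) = fun _ => φ 0 0 y from
        funext fun s => by rw [hconst 0 s 0], deriv_const]
    rw [hd, hconst _ t 0, hconst _ t 0, hconst _ t 0] at h
    rw [hd] at h₀
    linear_combination (h₀ - h) / 2
  have h₁ := key 1
  have h₂ := key 2
  refine sub_eq_zero.mp (mul_right_cancel₀ hy ?_)
  linear_combination h₁ / 3 - h₂ / 6

end DetEqEY

lemma eq_ite_even_of_add_two {X : Type*} {f : ℤ → X} (hper : ∀ n, f (n + 2) = f n) (n : ℤ) :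
    f n = if Even n then f 0 else f 1 := by
  have hp : Function.Periodic f 2 := hper
  split_ifs with hn
  · obtain ⟨k, rfl⟩ := hn
    simpa [← mul_two] using hp.int_mul k 0
  · obtain ⟨k, rfl⟩ := Int.not_even_iff_odd.mp hn
    simpa [mul_comm, add_comm] using hp.int_mul k 1

theorem symmetry_vector_fields_of_EYdKN
    (α β βh γ γh lam δ δh ω : ℝ)
    (hP : ¬(α = 0 ∧ β = 0 ∧ γ = 0))
    (τ : ℝ → ℝ) (φ : ℤ → ℝ → ℝ → ℝ)
    (hτ : ContDiff ℝ 2 τ)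
    (hφ : ∀ n : ℤ, ContDiff ℝ 2 (fun p : ℝ × ℝ => φ n p.1 p.2))
    (hdet : DetEqEY α β βh γ γh lam δ δh ω τ φ) :
    ∃ τ₀ τ₁ a ah b bh c ch : ℝ,
      (∀ t : ℝ, τ t = τ₀ + τ₁ * t) ∧
      (∀ (n : ℤ) (t u : ℝ),
        φ n t u = (a + ah * (-1 : ℝ) ^ n) + (b + bh * (-1 : ℝ) ^ n) * u
          + (c + ch * (-1 : ℝ) ^ n) * u ^ 2) := by
  have hcont : ∀ n t, Continuous (φ n t) := fun n t =>
    (hφ n).continuous.comp (Continuous.prodMk_right t)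
  have hper := hdet.apply_add_two hP hcont
  have hconst : ∀ n s t, φ n s = φ n t := fun n s t => funext fun y =>
    is_const_of_deriv_eq_zero (f := fun s => φ n s y)
      (((hφ n).differentiable two_ne_zero).comp
        (differentiable_id.prodMk (differentiable_const y)))
      (fun t => hdet.deriv_time_eq_zero hper n t y) s t
  have hτd : Differentiable ℝ τ := hτ.differentiable two_ne_zero
  obtain ⟨a₀, b₀, c₀, h₀⟩ := hdet.exists_quadratic hP 0 0
  obtain ⟨a₁, b₁, c₁, h₁⟩ := hdet.exists_quadratic hP 1 0
  refine ⟨τ 0, deriv τ 0, (a₀ + a₁) / 2, (a₀ - a₁) / 2, (b₀ + b₁) / 2, (b₀ - b₁) / 2,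
    (c₀ + c₁) / 2, (c₀ - c₁) / 2, fun t => ?_, fun n t u => ?_⟩
  · have h := is_const_of_deriv_eq_zero (f := fun s => τ s - deriv τ 0 * s)
      (by fun_prop) (fun s => ?_) t 0
    · linear_combination h
    · have hs := (hτd s).hasDerivAt.sub ((hasDerivAt_id s).const_mul (deriv τ 0))
      refine hs.deriv.trans ?_
      rw [hdet.deriv_tau_eq hP hconst s, mul_one, sub_self]
  · rw [hconst n t 0, eq_ite_even_of_add_two hper n]
    split_ifs with hn
    · rw [h₀, hn.neg_one_zpow]
      ring
    · rw [h₁, (Int.not_even_iff_odd.mp hn).neg_one_zpow]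
      ring
end

section
/- Let κ ∈ ℝ and let u : ℤ → ℝ → ℝ be such that each u_n is differentiable, u_{n+1}(t) ≠ u_{n−1}(t) for all n ∈ ℤ and t ∈ ℝ, and u solves the EYdKN equation with coefficients (α,β,β̂,γ,γ̂,λ,δ,δ̂,ω). Then v_n(t) := u_n(t) − κ solves the EYdKN equation with the translated coefficients α* = α, β* = β + ακ, β̂* = β̂ + ακ, γ* = γ + 2βκ + ακ², γ̂* = γ̂ + 2β̂κ + ακ², λ* = λ + 2(β+β̂)κ + 2ακ², δ* = δ + (γ+λ)κ + (2β+β̂)κ² + ακ³, δ̂* = δ̂ + (γ̂+λ)κ + (β+2β̂)κ² + ακ³, ω* = ω + 2(δ+δ̂)κ + (γ+γ̂+2λ)κ² + 2(β+β̂)κ³ + ακ⁴, and v_{n+1}(t) ≠ v_{n−1}(t) for all n, t. -/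
/-- `u : ℤ → ℝ → ℝ` solves the EYdKN equation with coefficients
(α, β, β̂, γ, γ̂, λ, δ, δ̂, ω), where P(u) = αu² + 2βu + γ, Q(u) = β̂u² + λu + δ,
R(u) = γ̂u² + 2δ̂u + ω. -/
def SolvesEY (α β βh γ γh lam δ δh ω : ℝ) (u : ℤ → ℝ → ℝ) : Prop :=
  ∀ (n : ℤ) (t : ℝ),
    HasDerivAt (u n)
      (((α * (u n t) ^ 2 + 2 * β * (u n t) + γ) * u (n + 1) t * u (n - 1) t
        + (βh * (u n t) ^ 2 + lam * (u n t) + δ) * (u (n + 1) t + u (n - 1) t)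
        + (γh * (u n t) ^ 2 + 2 * δh * (u n t) + ω))
       / (u (n + 1) t - u (n - 1) t)) t

theorem eydkn_translation_invariance
    (α β βh γ γh lam δ δh ω κ : ℝ) (u : ℤ → ℝ → ℝ)
    (hneq : ∀ (n : ℤ) (t : ℝ), u (n + 1) t ≠ u (n - 1) t)
    (hsol : SolvesEY α β βh γ γh lam δ δh ω u) :
    (∀ (n : ℤ) (t : ℝ), u (n + 1) t - κ ≠ u (n - 1) t - κ) ∧
    SolvesEY α (β + α * κ) (βh + α * κ)
      (γ + 2 * β * κ + α * κ ^ 2) (γh + 2 * βh * κ + α * κ ^ 2)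
      (lam + 2 * (β + βh) * κ + 2 * α * κ ^ 2)
      (δ + (γ + lam) * κ + (2 * β + βh) * κ ^ 2 + α * κ ^ 3)
      (δh + (γh + lam) * κ + (β + 2 * βh) * κ ^ 2 + α * κ ^ 3)
      (ω + 2 * (δ + δh) * κ + (γ + γh + 2 * lam) * κ ^ 2
        + 2 * (β + βh) * κ ^ 3 + α * κ ^ 4)
      (fun n t => u n t - κ) := by
  refine ⟨fun n t h => hneq n t (sub_left_injective h), fun n t => ?_⟩
  refine ((hsol n t).sub_const κ).congr_deriv ?_
  dsimp only
  congr 1 <;> ring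
end

section
/- Let u : ℤ → ℝ → ℝ be such that each u_n is differentiable, u_n(t) ≠ 0 and u_{n+1}(t) ≠ u_{n−1}(t) for all n ∈ ℤ and t ∈ ℝ, and u solves the EYdKN equation with coefficients (α,β,β̂,γ,γ̂,λ,δ,δ̂,ω). Then v_n(t) := 1/u_n(t) satisfies v_{n+1}(t) ≠ v_{n−1}(t) for all n, t and solves the EYdKN equation with the inverted coefficients α* = ω, β* = δ̂, β̂* = δ, γ* = γ̂, γ̂* = γ, λ* = λ, δ* = β̂, δ̂* = β, ω* = α. -/
theorem eydkn_inversion_invariance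
    (α β βh γ γh lam δ δh ω : ℝ) (u : ℤ → ℝ → ℝ)
    (hne0 : ∀ (n : ℤ) (t : ℝ), u n t ≠ 0)
    (hneq : ∀ (n : ℤ) (t : ℝ), u (n + 1) t ≠ u (n - 1) t)
    (hsol : SolvesEY α β βh γ γh lam δ δh ω u) :
    (∀ (n : ℤ) (t : ℝ), 1 / u (n + 1) t ≠ 1 / u (n - 1) t) ∧
    SolvesEY ω δh δ γh γ lam βh β α (fun n t => 1 / u n t) := by
  refine ⟨fun n t h => hneq n t (by simpa using h), fun n t => ?_⟩
  have hd : u (n + 1) t - u (n - 1) t ≠ 0 := sub_ne_zero.mpr (hneq n t)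
  have h0 := hne0 n t
  have hp := hne0 (n + 1) t
  have hm := hne0 (n - 1) t
  have hden : 1 / u (n + 1) t - 1 / u (n - 1) t
      = -(u (n + 1) t - u (n - 1) t) / (u (n + 1) t * u (n - 1) t) := by
    field_simp
    ring
  simp only [hden]
  have hinv := (hsol n t).fun_inv h0
  simp only [← one_div (u n _)] at hinv
  refine hinv.congr_deriv ?_
  field_simp
  ring
end

section
/- Let α, β, γ, δ, k ∈ ℝ with Δ := αδ − βγ ≠ 0 and k ≠ 0, let f : ℝ → ℝ be C¹, and define f̃(v) = (k⁴/Δ²)·f((αv+β)/(γv+δ))·(γv+δ)⁴ for all v with γv + δ ≠ 0. Suppose ũ : ℝ² → ℝ is a smooth (C^∞) function with ∂_x ũ(x,t) ≠ 0 and γũ(x,t) + δ ≠ 0 for all (x,t), solving the generalized Krichever–Novikov equation with nonlinearity f̃: ∂_t ũ = ∂_x³ ũ − (3/2)(∂_x² ũ)²/∂_x ũ + f̃(ũ)/∂_x ũ. Then u(x,t) := (α·ũ(x/k, t/k³) + β)/(γ·ũ(x/k, t/k³) + δ) satisfies ∂_x u(x,t) ≠ 0 everywhere and solves the generalized Krichever–Novikov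 equation with nonlinearity f: ∂_t u = ∂_x³ u − (3/2)(∂_x² u)²/∂_x u + f(u)/∂_x u. -/
lemma hasDerivAt_mobius_comp_div {α β γ δ c s g' : ℝ} {g : ℝ → ℝ}
    (hg : HasDerivAt g g' (s / c)) (hD : γ * g (s / c) + δ ≠ 0) :
    HasDerivAt (fun s => (α * g (s / c) + β) / (γ * g (s / c) + δ))
      ((α * δ - β * γ) / c * (g' / (γ * g (s / c) + δ) ^ 2)) s := by
  have hgs : HasDerivAt (fun s => g (s / c)) (g' * (1 / c)) s :=
    hg.comp s ((hasDerivAt_id s).div_const c)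
  refine (((hgs.const_mul α).add_const β).fun_div ((hgs.const_mul γ).add_const δ) hD).congr_deriv ?_
  field_simp
  ring

lemma iteratedDeriv_two_three_mobius_comp_div {α β γ δ k : ℝ} {g g₁ g₂ g₃ : ℝ → ℝ}
    (h₁ : ∀ s, HasDerivAt g (g₁ s) s) (h₂ : ∀ s, HasDerivAt g₁ (g₂ s) s)
    (h₃ : ∀ s, HasDerivAt g₂ (g₃ s) s) (hD : ∀ s, γ * g s + δ ≠ 0) (x : ℝ) :
    iteratedDeriv 2 (fun x => (α * g (x / k) + β) / (γ * g (x / k) + δ)) x =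
      (α * δ - β * γ) / k ^ 2 * (g₂ (x / k) / (γ * g (x / k) + δ) ^ 2
        - 2 * γ * g₁ (x / k) ^ 2 / (γ * g (x / k) + δ) ^ 3) ∧
    iteratedDeriv 3 (fun x => (α * g (x / k) + β) / (γ * g (x / k) + δ)) x =
      (α * δ - β * γ) / k ^ 3 * (g₃ (x / k) / (γ * g (x / k) + δ) ^ 2
        - 6 * γ * g₁ (x / k) * g₂ (x / k) / (γ * g (x / k) + δ) ^ 3
        + 6 * γ ^ 2 * g₁ (x / k) ^ 3 / (γ * g (x / k) + δ) ^ 4) := by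
  have scale {φ φ' : ℝ → ℝ} (h : ∀ s, HasDerivAt φ (φ' s) s) (s : ℝ) :
      HasDerivAt (fun s => φ (s / k)) (φ' (s / k) * (1 / k)) s :=
    (h (s / k)).comp s ((hasDerivAt_id s).div_const k)
  have hden (s : ℝ) := ((scale h₁ s).const_mul γ).add_const δ
  have e₁ : deriv (fun x => (α * g (x / k) + β) / (γ * g (x / k) + δ)) =
      fun x => (α * δ - β * γ) / k * (g₁ (x / k) / (γ * g (x / k) + δ) ^ 2) :=
    funext fun s => (hasDerivAt_mobius_comp_div (h₁ _) (hD _)).deriv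
  have e₂ : deriv (fun x => (α * δ - β * γ) / k * (g₁ (x / k) / (γ * g (x / k) + δ) ^ 2)) =
      fun x => (α * δ - β * γ) / k ^ 2 * (g₂ (x / k) / (γ * g (x / k) + δ) ^ 2
        - 2 * γ * g₁ (x / k) ^ 2 / (γ * g (x / k) + δ) ^ 3) := by
    funext s
    have hDs := hD (s / k)
    refine HasDerivAt.deriv ?_
    refine HasDerivAt.congr_deriv (((scale h₂ s).fun_div ((hden s).fun_pow 2) (pow_ne_zero 2 hDs)).const_mul
      ((α * δ - β * γ) / k)) ?_
    field_simp
    ring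
  have e₃ : deriv (fun x => (α * δ - β * γ) / k ^ 2 * (g₂ (x / k) / (γ * g (x / k) + δ) ^ 2
        - 2 * γ * g₁ (x / k) ^ 2 / (γ * g (x / k) + δ) ^ 3)) =
      fun x => (α * δ - β * γ) / k ^ 3 * (g₃ (x / k) / (γ * g (x / k) + δ) ^ 2
        - 6 * γ * g₁ (x / k) * g₂ (x / k) / (γ * g (x / k) + δ) ^ 3
        + 6 * γ ^ 2 * g₁ (x / k) ^ 3 / (γ * g (x / k) + δ) ^ 4) := by
    funext s
    have hDs := hD (s / k)
    refine HasDerivAt.deriv ?_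
    refine HasDerivAt.congr_deriv ((((scale h₃ s).fun_div ((hden s).fun_pow 2) (pow_ne_zero 2 hDs)).fun_sub
      ((((scale h₂ s).fun_pow 2).const_mul (2 * γ)).fun_div ((hden s).fun_pow 3)
        (pow_ne_zero 3 hDs))).const_mul ((α * δ - β * γ) / k ^ 2)) ?_
    field_simp
    ring
  constructor
  · simp only [iteratedDeriv_succ, iteratedDeriv_zero, e₁, e₂]
  · simp only [iteratedDeriv_succ, iteratedDeriv_zero, e₁, e₂, e₃]

lemma ContDiff.hasDerivAt_iteratedDeriv {g : ℝ → ℝ} (hg : ContDiff ℝ (⊤ : ℕ∞) g) (n : ℕ)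
    (s : ℝ) : HasDerivAt (iteratedDeriv n g) (iteratedDeriv (n + 1) g s) s := by
  rw [iteratedDeriv_succ]
  exact (hg.differentiable_iteratedDeriv n (by exact_mod_cast WithTop.coe_lt_top n) s).hasDerivAt


/-- First partial derivative in x of u = u(x,t). -/
noncomputable def pdX (u : ℝ → ℝ → ℝ) (x t : ℝ) : ℝ := deriv (fun x' => u x' t) x

/-- Second partial derivative in x of u = u(x,t). -/
noncomputable def pdXX (u : ℝ → ℝ → ℝ) (x t : ℝ) : ℝ :=
  iteratedDeriv 2 (fun x' => u x' t) x

/-- Third partial derivative in x of u = u(x,t). -/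
noncomputable def pdXXX (u : ℝ → ℝ → ℝ) (x t : ℝ) : ℝ :=
  iteratedDeriv 3 (fun x' => u x' t) x

/-- Partial derivative in t of u = u(x,t). -/
noncomputable def pdT (u : ℝ → ℝ → ℝ) (x t : ℝ) : ℝ := deriv (fun t' => u x t') t

/-- u solves the generalized Krichever–Novikov equation
u_t = u_xxx − (3/2) u_xx² / u_x + f(u)/u_x. -/
def SolvesGKN (f : ℝ → ℝ) (u : ℝ → ℝ → ℝ) : Prop :=
  ∀ x t : ℝ,
    pdT u x t = pdXXX u x t - (3 / 2) * (pdXX u x t) ^ 2 / pdX u x t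
      + f (u x t) / pdX u x t

theorem gkn_allowed_transformation
    (α β γ δ k : ℝ) (hΔ : α * δ - β * γ ≠ 0) (hk : k ≠ 0)
    (f : ℝ → ℝ) (hf : ContDiff ℝ 1 f)
    (ft : ℝ → ℝ)
    (hft : ∀ v : ℝ, γ * v + δ ≠ 0 →
      ft v = (k ^ 4 / (α * δ - β * γ) ^ 2) * f ((α * v + β) / (γ * v + δ))
        * (γ * v + δ) ^ 4)
    (ut : ℝ → ℝ → ℝ)
    (hsmooth : ContDiff ℝ (⊤ : ℕ∞) (fun p : ℝ × ℝ => ut p.1 p.2))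
    (hux : ∀ x t : ℝ, pdX ut x t ≠ 0)
    (hreg : ∀ x t : ℝ, γ * ut x t + δ ≠ 0)
    (hsol : SolvesGKN ft ut) :
    (∀ x t : ℝ,
      pdX (fun x t => (α * ut (x / k) (t / k ^ 3) + β)
        / (γ * ut (x / k) (t / k ^ 3) + δ)) x t ≠ 0) ∧
    SolvesGKN f (fun x t => (α * ut (x / k) (t / k ^ 3) + β)
        / (γ * ut (x / k) (t / k ^ 3) + δ)) := by
  have hX (t : ℝ) : ContDiff ℝ (⊤ : ℕ∞) (fun x => ut x t) :=
    hsmooth.comp (contDiff_id.prodMk contDiff_const)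
  have hT (x : ℝ) : ContDiff ℝ (⊤ : ℕ∞) (fun t => ut x t) :=
    hsmooth.comp (contDiff_const.prodMk contDiff_id)
  have h₁ (t s : ℝ) : HasDerivAt (fun x => ut x t) (pdX ut s t) s :=
    ((hX t).differentiable (by simp) s).hasDerivAt
  have h₂ (t s : ℝ) : HasDerivAt (fun x => pdX ut x t) (pdXX ut s t) s := by
    have h := (hX t).hasDerivAt_iteratedDeriv 1 s
    rw [iteratedDeriv_one] at h
    exact h
  have h₃ (t s : ℝ) : HasDerivAt (fun x => pdXX ut x t) (pdXXX ut s t) s :=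
    (hX t).hasDerivAt_iteratedDeriv 2 s
  have hτ (x s : ℝ) : HasDerivAt (fun t => ut x t) (pdT ut x s) s :=
    ((hT x).differentiable (by simp) s).hasDerivAt
  have eX (x t : ℝ) : pdX (fun x t => (α * ut (x / k) (t / k ^ 3) + β)
      / (γ * ut (x / k) (t / k ^ 3) + δ)) x t = (α * δ - β * γ) / k *
        (pdX ut (x / k) (t / k ^ 3) / (γ * ut (x / k) (t / k ^ 3) + δ) ^ 2) :=
    (hasDerivAt_mobius_comp_div (h₁ (t / k ^ 3) (x / k)) (hreg _ _)).deriv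
  have eT (x t : ℝ) : pdT (fun x t => (α * ut (x / k) (t / k ^ 3) + β)
      / (γ * ut (x / k) (t / k ^ 3) + δ)) x t = (α * δ - β * γ) / k ^ 3 *
        (pdT ut (x / k) (t / k ^ 3) / (γ * ut (x / k) (t / k ^ 3) + δ) ^ 2) :=
    (hasDerivAt_mobius_comp_div (hτ (x / k) (t / k ^ 3)) (hreg _ _)).deriv
  constructor
  · intro x t
    rw [eX]
    exact mul_ne_zero (div_ne_zero hΔ hk) (div_ne_zero (hux _ _) (pow_ne_zero 2 (hreg _ _)))
  · intro x t
    obtain ⟨eXX, eXXX⟩ := iteratedDeriv_two_three_mobius_comp_div (α := α) (β := β) (k := k)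
      (h₁ (t / k ^ 3)) (h₂ (t / k ^ 3)) (h₃ (t / k ^ 3)) (fun s => hreg s (t / k ^ 3)) x
    rw [eX, eT, pdXX, pdXXX, eXX, eXXX, hsol, hft _ (hreg _ _)]
    have hD := hreg (x / k) (t / k ^ 3)
    have hp := hux (x / k) (t / k ^ 3)
    generalize f _ = F
    generalize pdX ut (x / k) (t / k ^ 3) = p at *
    generalize pdXX ut (x / k) (t / k ^ 3) = q
    generalize pdXXX ut (x / k) (t / k ^ 3) = r
    generalize γ * ut (x / k) (t / k ^ 3) + δ = D at *
    generalize α * δ - β * γ = E at *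
    field_simp
    ring
end

section
/- Let α, β, γ, δ ∈ ℝ with αδ − βγ ≠ 0, and let u : ℝ² → ℝ be a smooth (C^∞) function with ∂_x u(x,t) ≠ 0 and γu(x,t) + δ ≠ 0 for all (x,t), solving the Schwarzian KdV equation ∂_t u = ∂_x³ u − (3/2)(∂_x² u)²/∂_x u. Then v(x,t) := (αu(x,t) + β)/(γu(x,t) + δ) satisfies ∂_x v(x,t) ≠ 0 everywhere and solves the same equation ∂_t v = ∂_x³ v − (3/2)(∂_x² v)²/∂_x v. -/
/-- The derivative of a Möbius transform of `f`. -/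
theorem HasDerivAt.moebius {f : ℝ → ℝ} {f' x : ℝ} (α β γ δ : ℝ)
    (hf : HasDerivAt f f' x) (hx : γ * f x + δ ≠ 0) :
    HasDerivAt (fun y => (α * f y + β) / (γ * f y + δ))
      ((α * δ - β * γ) * f' / (γ * f x + δ) ^ 2) x := by
  refine (((hf.const_mul α).add_const β).fun_div ((hf.const_mul γ).add_const δ) hx).congr_deriv ?_
  ring

/-- The second derivative of a Möbius transform of `f`, where `f` has derivative `g`. -/
theorem HasDerivAt.moebius_second {f g : ℝ → ℝ} {g' x : ℝ} (Δ γ δ : ℝ)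
    (hf : HasDerivAt f (g x) x) (hg : HasDerivAt g g' x) (hx : γ * f x + δ ≠ 0) :
    HasDerivAt (fun y => Δ * g y / (γ * f y + δ) ^ 2)
      (Δ * (g' * (γ * f x + δ) - 2 * γ * g x ^ 2) / (γ * f x + δ) ^ 3) x := by
  refine ((hg.const_mul Δ).fun_div (((hf.const_mul γ).add_const δ).fun_pow 2)
    (pow_ne_zero 2 hx)).congr_deriv ?_
  field_simp
  ring

/-- The third derivative of a Möbius transform of `f`, where `f` has derivatives `g` and `h`. -/
theorem HasDerivAt.moebius_third {f g h : ℝ → ℝ} {h' x : ℝ} (Δ γ δ : ℝ)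
    (hf : HasDerivAt f (g x) x) (hg : HasDerivAt g (h x) x) (hh : HasDerivAt h h' x)
    (hx : γ * f x + δ ≠ 0) :
    HasDerivAt (fun y => Δ * (h y * (γ * f y + δ) - 2 * γ * g y ^ 2) / (γ * f y + δ) ^ 3)
      (Δ * (h' * (γ * f x + δ) ^ 2 - 6 * γ * g x * h x * (γ * f x + δ) + 6 * γ ^ 2 * g x ^ 3) /
        (γ * f x + δ) ^ 4) x := by
  have hw := (hf.const_mul γ).add_const δ
  refine ((((hh.fun_mul hw).fun_sub ((hg.fun_pow 2).const_mul (2 * γ))).const_mul Δ).fun_div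
    (hw.fun_pow 3) (pow_ne_zero 3 hx)).congr_deriv ?_
  field_simp
  ring

/-- The iterated derivatives of a smooth function are derivatives of one another. -/
theorem ContDiff.hasDerivAt_iteratedDeriv_s6 {f : ℝ → ℝ} (hf : ContDiff ℝ (⊤ : ℕ∞) f) (n : ℕ)
    (x : ℝ) : HasDerivAt (iteratedDeriv n f) (iteratedDeriv (n + 1) f x) x := by
  rw [iteratedDeriv_succ]
  exact (hf.differentiable_iteratedDeriv n (by exact_mod_cast ENat.natCast_lt_top n) x).hasDerivAt

theorem schwarzian_kdv_moebius_invariance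
    (α β γ δ : ℝ) (hΔ : α * δ - β * γ ≠ 0)
    (u : ℝ → ℝ → ℝ)
    (hsmooth : ContDiff ℝ (⊤ : ℕ∞) (fun p : ℝ × ℝ => u p.1 p.2))
    (hux : ∀ x t : ℝ, pdX u x t ≠ 0)
    (hreg : ∀ x t : ℝ, γ * u x t + δ ≠ 0)
    (hsol : SolvesGKN (fun _ => 0) u) :
    (∀ x t : ℝ,
      pdX (fun x t => (α * u x t + β) / (γ * u x t + δ)) x t ≠ 0) ∧
    SolvesGKN (fun _ => 0) (fun x t => (α * u x t + β) / (γ * u x t + δ)) := by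
  have hX (t : ℝ) : ContDiff ℝ (⊤ : ℕ∞) (fun x => u x t) :=
    hsmooth.comp (contDiff_id.prodMk contDiff_const)
  have hT (x : ℝ) : ContDiff ℝ (⊤ : ℕ∞) (fun t => u x t) :=
    hsmooth.comp (contDiff_const.prodMk contDiff_id)
  have h1 (x t : ℝ) : HasDerivAt (fun y => u y t) (pdX u x t) x :=
    ((hX t).differentiable (by simp) x).hasDerivAt
  have h2 (x t : ℝ) : HasDerivAt (fun y => pdX u y t) (pdXX u x t) x := by
    have h := (hX t).hasDerivAt_iteratedDeriv_s6 1 x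
    rwa [iteratedDeriv_one] at h
  have h3 (x t : ℝ) : HasDerivAt (fun y => pdXX u y t) (pdXXX u x t) x :=
    (hX t).hasDerivAt_iteratedDeriv_s6 2 x
  have ht (x t : ℝ) : HasDerivAt (fun s => u x s) (pdT u x t) t :=
    ((hT x).differentiable (by simp) t).hasDerivAt
  set v : ℝ → ℝ → ℝ := fun x t => (α * u x t + β) / (γ * u x t + δ)
  have v1 (t : ℝ) : deriv (fun y => v y t) =
      fun x => (α * δ - β * γ) * pdX u x t / (γ * u x t + δ) ^ 2 :=
    funext fun x => ((h1 x t).moebius α β γ δ (hreg x t)).deriv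
  have v2 (t : ℝ) : iteratedDeriv 2 (fun y => v y t) = fun x => (α * δ - β * γ) *
      (pdXX u x t * (γ * u x t + δ) - 2 * γ * pdX u x t ^ 2) / (γ * u x t + δ) ^ 3 := by
    rw [iteratedDeriv_succ, iteratedDeriv_one, v1]
    exact funext fun x => ((h1 x t).moebius_second _ γ δ (h2 x t) (hreg x t)).deriv
  have vxxx (x t : ℝ) : pdXXX v x t = (α * δ - β * γ) *
      (pdXXX u x t * (γ * u x t + δ) ^ 2 - 6 * γ * pdX u x t * pdXX u x t * (γ * u x t + δ) +
        6 * γ ^ 2 * pdX u x t ^ 3) / (γ * u x t + δ) ^ 4 := by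
    rw [pdXXX, iteratedDeriv_succ, v2]
    exact ((h1 x t).moebius_third _ γ δ (h2 x t) (h3 x t) (hreg x t)).deriv
  have vx (x t : ℝ) : pdX v x t = (α * δ - β * γ) * pdX u x t / (γ * u x t + δ) ^ 2 :=
    congrFun (v1 t) x
  have vxx (x t : ℝ) : pdXX v x t = (α * δ - β * γ) *
      (pdXX u x t * (γ * u x t + δ) - 2 * γ * pdX u x t ^ 2) / (γ * u x t + δ) ^ 3 :=
    congrFun (v2 t) x
  have vt (x t : ℝ) : pdT v x t = (α * δ - β * γ) * pdT u x t / (γ * u x t + δ) ^ 2 :=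
    ((ht x t).moebius α β γ δ (hreg x t)).deriv
  refine ⟨fun x t => ?_, fun x t => ?_⟩
  · rw [vx]
    exact div_ne_zero (mul_ne_zero hΔ (hux x t)) (pow_ne_zero 2 (hreg x t))
  · rw [vt, vxxx, vxx, vx, hsol x t]
    have hw := hreg x t
    have hp := hux x t
    simp only [zero_div, add_zero]
    generalize α * δ - β * γ = Δ at *
    generalize γ * u x t + δ = w at *
    field_simp
    ring
end

section
/- Let u : ℤ → ℝ → ℝ be such that each u_n is differentiable, u_{n+1}(t) ≠ u_{n−1}(t) for all n ∈ ℤ and t ∈ ℝ, and u solves du_n/dt = u_n²u_{n+1}u_{n−1}/(u_{n+1} − u_{n−1}). Then each of the following functions v : ℤ → ℝ → ℝ again satisfies v_{n+1}(t) ≠ v_{n−1}(t) and solves the same equation dv_n/dt = v_n²v_{n+1}v_{n−1}/(v_{n+1} − v_{n−1}): (i) v_n(t) = s·u_n(s²t) for any s ≠ 0; (ii) v_n(t) = e^{(−1)ⁿε}·u_n(t) for any ε ∈ ℝ; (iii) v_n(t) = u_n(t)/(1 − ε·u_n(t)) for any ε ∈ ℝ such that 1 − ε·u_m(t) ≠ 0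 for all m, t; (iv) v_n(t) = u_n(t)/(1 − (−1)ⁿε·u_n(t)) for any ε ∈ ℝ such that 1 − (−1)^m ε·u_m(t) ≠ 0 for all m, t. These are the one-parameter symmetry groups generated by X₁ = 2t∂_t − u_n∂_{u_n}, X₂ = (−1)ⁿu_n∂_{u_n}, X₃ = u_n²∂_{u_n}, X₄ = (−1)ⁿu_n²∂_{u_n}. -/
/-- `u` solves the YdKN instance du_n/dt = u_n² u_{n+1} u_{n−1} / (u_{n+1} − u_{n−1}). -/
def SolvesYdKN5 (u : ℤ → ℝ → ℝ) : Prop :=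
  ∀ (n : ℤ) (t : ℝ),
    HasDerivAt (u n)
      ((u n t) ^ 2 * u (n + 1) t * u (n - 1) t / (u (n + 1) t - u (n - 1) t)) t

/-- `v` is again admissible: neighbours stay distinct and it solves the same equation. -/
def GoodYdKN5 (v : ℤ → ℝ → ℝ) : Prop :=
  (∀ (n : ℤ) (t : ℝ), v (n + 1) t ≠ v (n - 1) t) ∧ SolvesYdKN5 v

theorem neg_one_zpow_add_one (n : ℤ) : (-1 : ℝ) ^ (n + 1) = -(-1 : ℝ) ^ n := by
  rw [zpow_add_one₀ (by norm_num), mul_neg_one]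

theorem neg_one_zpow_sub_one (n : ℤ) : (-1 : ℝ) ^ (n - 1) = -(-1 : ℝ) ^ n := by
  rw [zpow_sub_one₀ (by norm_num), inv_neg_one, mul_neg_one]

/-- Scaling `u` by `s` and time by `s ^ 2` preserves solutions. -/
theorem GoodYdKN5.scale {u : ℤ → ℝ → ℝ} (hu : GoodYdKN5 u) {s : ℝ} (hs : s ≠ 0) :
    GoodYdKN5 (fun n t => s * u n (s ^ 2 * t)) := by
  refine ⟨fun n t h => hu.1 n (s ^ 2 * t) (mul_left_cancel₀ hs h), fun n t => ?_⟩
  have hd := sub_ne_zero.mpr (hu.1 n (s ^ 2 * t))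
  have hderiv := ((hu.2 n (s ^ 2 * t)).comp t ((hasDerivAt_id t).const_mul (s ^ 2))).const_mul s
  refine hderiv.congr_deriv ?_
  simp only [← mul_sub]
  field_simp

/-- A gauge factor `g` with `g n * g (n ± 1) = 1` preserves solutions. -/
theorem GoodYdKN5.gauge {u : ℤ → ℝ → ℝ} (hu : GoodYdKN5 u) {g : ℤ → ℝ}
    (hg : ∀ n, g (n + 1) = g (n - 1)) (hmul : ∀ n, g n * g (n + 1) = 1) :
    GoodYdKN5 (fun n t => g n * u n t) := by
  have hne (n : ℤ) : g (n - 1) ≠ 0 := hg n ▸ right_ne_zero_of_mul_eq_one (hmul n)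
  refine ⟨fun n t h => hu.1 n t ?_, fun n t => ?_⟩
  · simp only [hg n] at h
    exact mul_left_cancel₀ (hne n) h
  · have hd := sub_ne_zero.mpr (hu.1 n t)
    have hn := hne n
    have hm := hmul n
    rw [hg n] at hm
    refine ((hu.2 n t).const_mul (g n)).congr_deriv ?_
    simp only [hg n, ← mul_sub]
    field_simp
    linear_combination (-(g n * u n t ^ 2 * u (n + 1) t * u (n - 1) t)) * hm

/-- The Möbius maps `x ↦ x / (1 - c n * x)`, with `c` of period two, preserve solutions. -/
theorem GoodYdKN5.moebius {u : ℤ → ℝ → ℝ} (hu : GoodYdKN5 u) {c : ℤ → ℝ}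
    (hc : ∀ n, c (n + 1) = c (n - 1)) (hne : ∀ n t, 1 - c n * u n t ≠ 0) :
    GoodYdKN5 (fun n t => u n t / (1 - c n * u n t)) := by
  have hsub (n : ℤ) (t : ℝ) :
      u (n + 1) t / (1 - c (n + 1) * u (n + 1) t) - u (n - 1) t / (1 - c (n - 1) * u (n - 1) t) =
        (u (n + 1) t - u (n - 1) t) /
          ((1 - c (n + 1) * u (n + 1) t) * (1 - c (n - 1) * u (n - 1) t)) := by
    rw [div_sub_div _ _ (hne _ t) (hne _ t), hc n]
    ring
  refine ⟨fun n t => sub_ne_zero.mp ?_, fun n t => ?_⟩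
  · simp only [hsub]
    exact div_ne_zero (sub_ne_zero.mpr (hu.1 n t)) (mul_ne_zero (hne _ t) (hne _ t))
  · have hd := sub_ne_zero.mpr (hu.1 n t)
    have h0 := hne n t
    have h1 := hne (n + 1) t
    have h2 := hne (n - 1) t
    have hderiv := (hu.2 n t).div (((hu.2 n t).const_mul (c n)).const_sub 1) h0
    refine hderiv.congr_deriv ?_
    have hnum (d : ℝ) : d * (1 - c n * u n t) - u n t * -(c n * d) = d := by ring
    simp only [hsub, hnum]
    generalize 1 - c n * u n t = x at *
    generalize 1 - c (n + 1) * u (n + 1) t = y at *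
    generalize 1 - c (n - 1) * u (n - 1) t = z at *
    field_simp

theorem ydkn5_symmetry_groups (u : ℤ → ℝ → ℝ)
    (hneq : ∀ (n : ℤ) (t : ℝ), u (n + 1) t ≠ u (n - 1) t)
    (hsol : SolvesYdKN5 u) :
    (∀ s : ℝ, s ≠ 0 → GoodYdKN5 (fun n t => s * u n (s ^ 2 * t))) ∧
    (∀ ε : ℝ, GoodYdKN5 (fun n t => Real.exp ((-1 : ℝ) ^ n * ε) * u n t)) ∧
    (∀ ε : ℝ, (∀ (m : ℤ) (t : ℝ), 1 - ε * u m t ≠ 0) →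
      GoodYdKN5 (fun n t => u n t / (1 - ε * u n t))) ∧
    (∀ ε : ℝ, (∀ (m : ℤ) (t : ℝ), 1 - (-1 : ℝ) ^ m * ε * u m t ≠ 0) →
      GoodYdKN5 (fun n t => u n t / (1 - (-1 : ℝ) ^ n * ε * u n t))) := by
  have hu : GoodYdKN5 u := ⟨hneq, hsol⟩
  refine ⟨fun s hs => hu.scale hs, fun ε => ?_, fun ε hε => ?_, fun ε hε => ?_⟩
  · refine hu.gauge (g := fun n => Real.exp ((-1 : ℝ) ^ n * ε)) (fun n => ?_) (fun n => ?_)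
    · simp only [neg_one_zpow_add_one, neg_one_zpow_sub_one]
    · simp only [neg_one_zpow_add_one, ← Real.exp_add, neg_mul, add_neg_cancel, Real.exp_zero]
  · exact hu.moebius (c := fun _ => ε) (fun _ => rfl) hε
  · refine hu.moebius (c := fun n => (-1 : ℝ) ^ n * ε) (fun n => ?_) hε
    simp only [neg_one_zpow_add_one, neg_one_zpow_sub_one]
end

section
/- Let τ₀, τ₁, a, â, b, b̂, c, ĉ ∈ ℝ and set τ(t) = τ₀ + τ₁t and φ(n,t,u) = (a + â(−1)ⁿ) + (b + b̂(−1)ⁿ)u + (c + ĉ(−1)ⁿ)u². Then the pair (τ,φ) satisfies the symmetry determining equation of the EYdKN equation with P(u) = u², Q(u) = 0, R(u) = 0 if and only if a = 0, â = 0 and τ₁ = −2b. Consequently the space of such symmetries is 5-dimensional, spanned by X₀ = ∂_t, X₁ = 2t∂_t − u_n∂_{u_n}, X₂ = (−1)ⁿu_n∂_{u_n}, X₃ = u_n²∂_{u_n}, X₄ = (−1)ⁿu_n²∂_{u_n}. -/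
theorem deriv_quadratic (A B C y : ℝ) :
    deriv (fun v : ℝ => A + B * v + C * v ^ 2) y = B + 2 * C * y := by
  have h : HasDerivAt (fun v : ℝ => A + B * v + C * v ^ 2)
      (B * 1 + C * (((2 : ℕ) : ℝ) * y ^ (2 - 1))) y :=
    (((hasDerivAt_id' y).const_mul B).const_add A).add ((hasDerivAt_pow 2 y).const_mul C)
  rw [h.deriv]
  norm_num
  ring

theorem deriv_affine (A B t : ℝ) : deriv (fun s : ℝ => A + B * s) t = B := by
  simp

theorem ydkn5_point_symmetries_classification
    (τ₀ τ₁ a ah b bh c ch : ℝ) :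
    DetEqEY 1 0 0 0 0 0 0 0 0
        (fun t => τ₀ + τ₁ * t)
        (fun n _ u => (a + ah * (-1 : ℝ) ^ n) + (b + bh * (-1 : ℝ) ^ n) * u
          + (c + ch * (-1 : ℝ) ^ n) * u ^ 2)
      ↔ (a = 0 ∧ ah = 0 ∧ τ₁ = -2 * b) := by
  have hpred (n : ℤ) : (-1 : ℝ) ^ (n - 1) = -(-1) ^ n := by
    rw [zpow_sub_one₀ (by norm_num)]
    norm_num
  have hsucc (n : ℤ) : (-1 : ℝ) ^ (n + 1) = -(-1) ^ n := by
    rw [zpow_add_one₀ (by norm_num)]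
    norm_num
  simp only [DetEqEY, deriv_const, deriv_quadratic, deriv_affine, hpred, hsucc]
  constructor
  · intro h
    have h₀ := h 0 0 0 1 1
    have h₁ := h 1 0 0 1 1
    have h₂ := h 0 0 1 1 2
    norm_num at h₀ h₁ h₂
    refine ⟨?_, ?_, ?_⟩ <;> linarith
  · rintro ⟨rfl, rfl, rfl⟩ n t x y z
    ring
end

section
/- Let a, b, c, d ∈ ℝ with ad − bc ≠ 0, and let u : ℤ → ℝ → ℝ be such that each u_n is differentiable, u_{n+1}(t) ≠ u_{n−1}(t) and c·u_n(t) + d ≠ 0 for all n ∈ ℤ and t ∈ ℝ, and u solves du_n/dt = (u_{n+1}u_{n−1} − u_n(u_{n+1} + u_{n−1}) + u_n²)/(u_{n+1} − u_{n−1}). Then v_n(t) := (a·u_n(t) + b)/(c·u_n(t) + d) satisfies v_{n+1}(t) ≠ v_{n−1}(t) for all n, t and solves the same equation dv_n/dt = (v_{n+1}v_{n−1} − v_n(v_{n+1} + v_{n−1}) + v_n²)/(v_{n+1} − v_{n−1}). This is the symmetry group exponentiating the four-dimensional algebra gl(2,ℝ) spanned by ∂_t, ∂_{u_n}, u_n∂_{u_n},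 u_n²∂_{u_n}. -/
/-- `u` solves du_n/dt = (u_{n+1}u_{n−1} − u_n(u_{n+1}+u_{n−1}) + u_n²)/(u_{n+1} − u_{n−1}). -/
def SolvesEq411 (u : ℤ → ℝ → ℝ) : Prop :=
  ∀ (n : ℤ) (t : ℝ),
    HasDerivAt (u n)
      ((u (n + 1) t * u (n - 1) t - u n t * (u (n + 1) t + u (n - 1) t)
        + (u n t) ^ 2) / (u (n + 1) t - u (n - 1) t)) t

/-- The difference of the images of two points under a Möbius map. -/
theorem moebius_sub_moebius {a b c d x y : ℝ} (hx : c * x + d ≠ 0) (hy : c * y + d ≠ 0) :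
    (a * x + b) / (c * x + d) - (a * y + b) / (c * y + d)
      = (a * d - b * c) * (x - y) / ((c * x + d) * (c * y + d)) := by
  rw [div_sub_div _ _ hx hy]
  ring

/-- The chain rule for a Möbius map applied to a differentiable function. -/
theorem HasDerivAt.moebius_s17 {a b c d f' t : ℝ} {f : ℝ → ℝ} (hf : HasDerivAt f f' t)
    (ht : c * f t + d ≠ 0) :
    HasDerivAt (fun s => (a * f s + b) / (c * f s + d))
      ((a * d - b * c) * f' / (c * f t + d) ^ 2) t := by
  refine (((hf.const_mul a).add_const b).fun_div ((hf.const_mul c).add_const d) ht).congr_deriv ?_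
  ring

/-- The right-hand side of the equation is transformed by a Möbius map in the same way as
a derivative. -/
theorem moebius_rhs {a b c d x y z : ℝ} (h : a * d - b * c ≠ 0) (hxz : x ≠ z)
    (hx : c * x + d ≠ 0) (hy : c * y + d ≠ 0) (hz : c * z + d ≠ 0) :
    (a * d - b * c) * ((x * z - y * (x + z) + y ^ 2) / (x - z)) / (c * y + d) ^ 2
      = ((a * x + b) / (c * x + d) * ((a * z + b) / (c * z + d))
          - (a * y + b) / (c * y + d) * ((a * x + b) / (c * x + d) + (a * z + b) / (c * z + d))
          + ((a * y + b) / (c * y + d)) ^ 2)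
        / ((a * x + b) / (c * x + d) - (a * z + b) / (c * z + d)) := by
  have factor (p q r : ℝ) : p * r - q * (p + r) + q ^ 2 = (p - q) * (r - q) := by ring
  have hsub : x - z ≠ 0 := sub_ne_zero.mpr hxz
  rw [factor, factor, moebius_sub_moebius hx hy, moebius_sub_moebius hz hy,
    moebius_sub_moebius hx hz]
  generalize a * d - b * c = D at *
  generalize c * x + d = X at *
  generalize c * y + d = Y at *
  generalize c * z + d = Z at *
  field_simp

theorem eq411_moebius_invariance
    (a b c d : ℝ) (h : a * d - b * c ≠ 0) (u : ℤ → ℝ → ℝ)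
    (hneq : ∀ (n : ℤ) (t : ℝ), u (n + 1) t ≠ u (n - 1) t)
    (hden : ∀ (n : ℤ) (t : ℝ), c * u n t + d ≠ 0)
    (hsol : SolvesEq411 u) :
    (∀ (n : ℤ) (t : ℝ),
      (a * u (n + 1) t + b) / (c * u (n + 1) t + d)
        ≠ (a * u (n - 1) t + b) / (c * u (n - 1) t + d)) ∧
    SolvesEq411 (fun n t => (a * u n t + b) / (c * u n t + d)) := by
  refine ⟨fun n t => ?_, fun n t => ?_⟩
  · rw [← sub_ne_zero, moebius_sub_moebius (hden _ t) (hden _ t)]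
    exact div_ne_zero (mul_ne_zero h (sub_ne_zero.mpr (hneq n t)))
      (mul_ne_zero (hden _ t) (hden _ t))
  · exact ((hsol n t).moebius_s17 (hden n t)).congr_deriv
      (moebius_rhs h (hneq n t) (hden _ t) (hden _ t) (hden _ t))
end

section
/- Consider the equation du_n/dt = u_n²u_{n+1}u_{n−1}/(u_{n+1} − u_{n−1}). (i) If c : ℤ → ℝ satisfies c_n ≠ 0 and c_n = (1/2)(1/c_{n+1} − 1/c_{n−1}) for all n ∈ ℤ, then c_{n+1} ≠ c_{n−1} for all n, and u_n(t) := c_n/√t is a solution of the equation for all t > 0 (with u_{n+1}(t) ≠ u_{n−1}(t)). (ii) If a ≠ 0, β ∈ ℝ and c_n := −(a²/2)n + β, then u_n(t) := a/(c_n − t) is a solution of the equation (with u_{n+1}(t) ≠ u_{n−1}(t)) for all n ∈ ℤ and all t with t ≠ c_m for m ∈ {n−1, n, n+1}. These are the solutions invariant under the symmetry subgroups generated by X₁ = 2t∂_t − u_n∂_{u_n} and by X₃ + aX₀ = u_n²∂_{u_n} + a∂_t, respectively. -/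
/-- The similarity solution u_n(t) = c_n/√t. -/
noncomputable def uSim (c : ℤ → ℝ) (n : ℤ) (t : ℝ) : ℝ := c n / Real.sqrt t

/-- The lattice sequence c_n = −(a²/2)n + β. -/
noncomputable def cLin (a β : ℝ) (n : ℤ) : ℝ := -(a ^ 2 / 2) * (n : ℝ) + β

/-- The invariant solution u_n(t) = a/(c_n − t). -/
noncomputable def uInv (a β : ℝ) (n : ℤ) (t : ℝ) : ℝ := a / (cLin a β n - t)

theorem mul_div_sub_eq_inv_inv_sub_inv {p q : ℝ} (hp : p ≠ 0) (hq : q ≠ 0) :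
    p * q / (p - q) = (q⁻¹ - p⁻¹)⁻¹ := by
  rw [inv_sub_inv hq hp, inv_div, mul_comm]

/-- The relation `1 / u_{n-1} - 1 / u_{n+1} = k` with `k ≠ 0` makes the right-hand side of the
lattice equation well defined and equal to `u_n² / k`. -/
theorem ne_and_hasDerivAt_of_inv_sub_inv {f : ℝ → ℝ} {t p q k : ℝ} (hp : p ≠ 0) (hq : q ≠ 0)
    (hk : k ≠ 0) (hpq : q⁻¹ - p⁻¹ = k) (hf : HasDerivAt f (f t ^ 2 / k) t) :
    p ≠ q ∧ HasDerivAt f (f t ^ 2 * p * q / (p - q)) t := by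
  refine ⟨fun h => hk (by rw [← hpq, h, sub_self]), ?_⟩
  rwa [mul_assoc, mul_div_assoc, mul_div_sub_eq_inv_inv_sub_inv hp hq, hpq, ← div_eq_mul_inv]

theorem hasDerivAt_uSim (c : ℤ → ℝ) (n : ℤ) {t : ℝ} (ht : 0 < t) :
    HasDerivAt (uSim c n) (uSim c n t ^ 2 / (-2 * c n * √t)) t := by
  have hs : √t ≠ 0 := (Real.sqrt_pos.2 ht).ne'
  refine ((hasDerivAt_const t (c n)).div (Real.hasDerivAt_sqrt ht.ne') hs).congr_deriv ?_
  rw [uSim]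
  field_simp
  ring

theorem hasDerivAt_uInv (a β : ℝ) {n : ℤ} {t : ℝ} (ht : t ≠ cLin a β n) :
    HasDerivAt (uInv a β n) (uInv a β n t ^ 2 / a) t := by
  have hs : cLin a β n - t ≠ 0 := sub_ne_zero.2 ht.symm
  refine ((hasDerivAt_const t a).div ((hasDerivAt_id t).const_sub (cLin a β n)) hs).congr_deriv ?_
  simp only [uInv, id]
  field_simp
  ring

theorem ydkn5_invariant_solutions :
    (∀ c : ℤ → ℝ, (∀ n : ℤ, c n ≠ 0) →
      (∀ n : ℤ, c n = (1 / 2) * (1 / c (n + 1) - 1 / c (n - 1))) →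
      (∀ n : ℤ, c (n + 1) ≠ c (n - 1)) ∧
      (∀ (n : ℤ) (t : ℝ), 0 < t →
        uSim c (n + 1) t ≠ uSim c (n - 1) t ∧
        HasDerivAt (uSim c n)
          ((uSim c n t) ^ 2 * uSim c (n + 1) t * uSim c (n - 1) t
            / (uSim c (n + 1) t - uSim c (n - 1) t)) t)) ∧
    (∀ a β : ℝ, a ≠ 0 →
      ∀ (n : ℤ) (t : ℝ),
        t ≠ cLin a β (n - 1) → t ≠ cLin a β n → t ≠ cLin a β (n + 1) →
        uInv a β (n + 1) t ≠ uInv a β (n - 1) t ∧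
        HasDerivAt (uInv a β n)
          ((uInv a β n t) ^ 2 * uInv a β (n + 1) t * uInv a β (n - 1) t
            / (uInv a β (n + 1) t - uInv a β (n - 1) t)) t) := by
  refine ⟨fun c hc hrec => ⟨fun n h => hc n ?_, fun n t ht => ?_⟩,
    fun a β ha n t hm hn hp => ?_⟩
  · rw [hrec n, h, sub_self, mul_zero]
  · have hs : √t ≠ 0 := (Real.sqrt_pos.2 ht).ne'
    refine ne_and_hasDerivAt_of_inv_sub_inv (div_ne_zero (hc _) hs) (div_ne_zero (hc _) hs)
      (mul_ne_zero (mul_ne_zero (by norm_num) (hc n)) hs) ?_ (hasDerivAt_uSim c n ht)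
    rw [uSim, uSim, inv_div, inv_div, hrec n]
    ring
  · refine ne_and_hasDerivAt_of_inv_sub_inv (div_ne_zero ha (sub_ne_zero.2 hp.symm))
      (div_ne_zero ha (sub_ne_zero.2 hm.symm)) ha ?_ (hasDerivAt_uInv a β hn)
    simp only [uInv, inv_div, cLin]
    push_cast
    field_simp
    ring
end
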